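/- Let N, k ∈ ℕ. For every unit vector ξ ∈ ℓ²(F_∞^k), the von Neumann entropy of the positive semidefinite Hermitian matrix G_k(ξ) (indexed by v,w ∈ {1,…,N}^k, with entries G_k(ξ)_{vw} = N^{-k}⟨U_w ξ, U_v ξ⟩) satisfies H(G_k(ξ)) ≥ k·log N − 2·log(1 + √((1 + 9/N)^k − 1)). In particular, the minimum output entropy of the k-fold tensor power Φ_N^{⊗k} of the quantum channel Φ_N(ρ) = N^{-1}Σ_{i=1}^N U_i ρ U_i^* satisfies H_min(Φ_N^{⊗k}) ≥ k·log N − 2·log(1 + √((1 + 9/N)^k − 1)). -/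

import Mathlib

open scoped ENNReal

noncomputable section

/-- The free group on countably many generators. -/
abbrev FG : Type := FreeGroup ℕ

/-- The generators `g_i` of the free group. -/
def gen (i : ℕ) : FG := FreeGroup.of i

/-- `ℓ²(F_∞^k)`. -/
abbrev l2 (k : ℕ) : Type := lp (fun _ : Fin k → FG => ℂ) 2

/-- The inner product `⟨U_w ξ, U_v ξ⟩ = Σ_x conj((U_w ξ)(x)) (U_v ξ)(x)`, where
`(U_v ξ)(x) = ξ(g_{v_1}^{-1}x_1, …, g_{v_k}^{-1}x_k)`. -/
def innerUU {N k : ℕ} (ξ : l2 k) (w v : Fin k → Fin N) : ℂ :=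
  ∑' x : Fin k → FG,
    (starRingEnd ℂ) (ξ (fun j => (gen (w j : ℕ))⁻¹ * x j)) *
      ξ (fun j => (gen (v j : ℕ))⁻¹ * x j)

/-- The Gram-type matrix `G_k(ξ)_{vw} = N^{-k}⟨U_w ξ, U_v ξ⟩`, i.e. the output of the
complementary channel of `Φ_N^{⊗k}` at the pure state `|ξ⟩⟨ξ|`. -/
def Gmat (N k : ℕ) (ξ : l2 k) : Matrix (Fin k → Fin N) (Fin k → Fin N) ℂ :=
  Matrix.of fun v w => ((N : ℂ) ^ k)⁻¹ * innerUU ξ w v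

/-- The von Neumann entropy of a (Hermitian) matrix: `H(M) = −Σ_i λ_i log λ_i`, where
the `λ_i` are the eigenvalues of `M` (junk value `0` for non-Hermitian matrices). -/
def vnEntropy {n : Type*} [Fintype n] [DecidableEq n] (M : Matrix n n ℂ) : ℝ :=
  if h : M.IsHermitian then ∑ i, Real.negMulLog (h.eigenvalues i) else 0

/-- The first letter of the reduced word of an element of the free group. -/
def firstLetter (x : FG) : Option (ℕ × Bool) := x.toWord.head?

lemma firstLetter_inv_gen_mul {i : ℕ} {x : FG} (h : firstLetter x ≠ some (i, true)) :
    firstLetter ((gen i)⁻¹ * x) = some (i, false) := by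
  have key : ((gen i)⁻¹ * x).toWord = FreeGroup.reduce ((i, false) :: x.toWord) := by
    rw [gen, FreeGroup.toWord_mul, FreeGroup.toWord_inv, FreeGroup.toWord_of]
    rfl
  unfold firstLetter at *
  rw [key, FreeGroup.reduce.cons, FreeGroup.reduce_toWord]
  rcases hx : x.toWord with _ | ⟨⟨j, b⟩, l⟩
  · simp
  · rw [hx] at h
    have hc : ¬(i = j ∧ false = !b) := by
      rintro ⟨rfl, hb⟩
      obtain rfl : b = true := by simpa using hb
      exact h rfl
    dsimp only
    rw [if_neg hc]
    rfl

open scoped Classical in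
/-- The one-coordinate weight: for `v ≠ w` it detects, with multiplicity three, the ways in which
`(a, b) = (g_w⁻¹ x, g_v⁻¹ x)` can arise. -/
def haagerupWeight {N : ℕ} (v w : Fin N) (a b : FG) : ℕ :=
  if v = w then 1 else
    3 * ((if firstLetter b = some (↑v, false) ∧ firstLetter (gen v * b) = some (↑w, true)
            then 1 else 0) +
      (if firstLetter a = some (↑w, false) ∧ firstLetter (gen w * a) = some (↑v, true)
            then 1 else 0) +
      (if firstLetter a = some (↑w, false) ∧ firstLetter b = some (↑v, false) then 1 else 0))

lemma sum_ite_le_one {ι : Type*} [Fintype ι] (P : ι → Prop) [DecidablePred P]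
    (h : ∀ i j, P i → P j → i = j) : ∑ i, (if P i then 1 else 0) ≤ 1 := by
  rw [← Finset.card_filter, Finset.card_le_one]
  intro i hi j hj
  exact h i j (Finset.mem_filter.1 hi).2 (Finset.mem_filter.1 hj).2

lemma sum_haagerupWeight_le (N : ℕ) (a b : FG) :
    ∑ p : Fin N × Fin N, haagerupWeight p.1 p.2 a b ≤ N + 9 := by
  classical
  have hle : ∀ p : Fin N × Fin N, haagerupWeight p.1 p.2 a b ≤
      (if p.1 = p.2 then 1 else 0) +
      3 * ((if firstLetter b = some (↑p.1, false) ∧ firstLetter (gen p.1 * b) = some (↑p.2, true)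
            then 1 else 0) +
      (if firstLetter a = some (↑p.2, false) ∧ firstLetter (gen p.2 * a) = some (↑p.1, true)
            then 1 else 0) +
      (if firstLetter a = some (↑p.2, false) ∧ firstLetter b = some (↑p.1, false)
            then 1 else 0)) := by
    intro p
    unfold haagerupWeight
    split_ifs <;> simp
  refine (Finset.sum_le_sum fun p _ => hle p).trans ?_
  rw [Finset.sum_add_distrib, ← Finset.mul_sum, Finset.sum_add_distrib, Finset.sum_add_distrib]
  have h0 : ∑ p : Fin N × Fin N, (if p.1 = p.2 then 1 else 0) = N := by
    rw [Fintype.sum_prod_type]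
    simp
  have h1 := sum_ite_le_one (fun p : Fin N × Fin N => firstLetter b = some (↑p.1, false) ∧
      firstLetter (gen p.1 * b) = some (↑p.2, true)) (by
    rintro ⟨v, w⟩ ⟨v', w'⟩ ⟨h, h'⟩ ⟨h2, h2'⟩
    have hv : v = v' := by
      apply Fin.ext
      simpa [h] using h2
    subst hv
    have hw : w = w' := by
      apply Fin.ext
      simpa [h'] using h2'
    rw [hw])
  have h2 := sum_ite_le_one (fun p : Fin N × Fin N => firstLetter a = some (↑p.2, false) ∧
      firstLetter (gen p.2 * a) = some (↑p.1, true)) (by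
    rintro ⟨v, w⟩ ⟨v', w'⟩ ⟨h, h'⟩ ⟨h2, h2'⟩
    have hw : w = w' := by
      apply Fin.ext
      simpa [h] using h2
    subst hw
    have hv : v = v' := by
      apply Fin.ext
      simpa [h'] using h2'
    rw [hv])
  have h3 := sum_ite_le_one (fun p : Fin N × Fin N => firstLetter a = some (↑p.2, false) ∧
      firstLetter b = some (↑p.1, false)) (by
    rintro ⟨v, w⟩ ⟨v', w'⟩ ⟨h, h'⟩ ⟨h2, h2'⟩
    have hw : w = w' := by
      apply Fin.ext
      simpa [h] using h2
    have hv : v = v' := by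
      apply Fin.ext
      simpa [h'] using h2'
    rw [hw, hv])
  omega

open scoped Classical in
/-- The cancellation pattern of `g_w⁻¹ x` and `g_v⁻¹ x`. -/
def cancelType {N : ℕ} (v w : Fin N) (x : FG) : Fin 3 :=
  if v = w then 0 else if firstLetter x = some (↑w, true) then 0
  else if firstLetter x = some (↑v, true) then 1 else 2

lemma card_le_haagerupWeight {N : ℕ} {v w : Fin N} {x y : FG}
    (h : cancelType v w x = cancelType v w y) :
    (if v = w then 1 else 3) ≤ haagerupWeight v w ((gen w)⁻¹ * x) ((gen v)⁻¹ * y) := by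
  unfold haagerupWeight
  by_cases hvw : v = w
  · simp [hvw]
  have hvw' : (v : ℕ) ≠ w := fun h => hvw (Fin.ext h)
  have hne : ∀ z : FG, firstLetter z = some (↑w, true) → firstLetter z ≠ some (↑v, true) := by
    intro z hz hz'
    rw [hz] at hz'
    exact hvw' (by simpa using hz'.symm)
  simp only [if_neg hvw, mul_inv_cancel_left]
  unfold cancelType at h
  rw [if_neg hvw, if_neg hvw] at h
  by_cases hy : firstLetter y = some (↑w, true)
  · rw [if_pos (show firstLetter ((gen v)⁻¹ * y) = some (↑v, false) ∧ _ from
      ⟨firstLetter_inv_gen_mul (hne y hy), hy⟩)]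
    omega
  · by_cases hx : firstLetter x = some (↑w, true)
    · simp only [if_pos hx, if_neg hy] at h
      split_ifs at h <;> simp at h
    · by_cases hx' : firstLetter x = some (↑v, true)
      · rw [if_pos (show firstLetter ((gen w)⁻¹ * x) = some (↑w, false) ∧ _ from
          ⟨firstLetter_inv_gen_mul hx, hx'⟩)]
        omega
      · have hy' : firstLetter y ≠ some (↑v, true) := by
          intro hy'
          simp [hx, hx', hy', hvw'] at h
        rw [if_pos (show firstLetter ((gen w)⁻¹ * x) = some (↑w, false) ∧
          firstLetter ((gen v)⁻¹ * y) = some (↑v, false) from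
          ⟨firstLetter_inv_gen_mul hx, firstLetter_inv_gen_mul hy'⟩)]
        omega

lemma sum_prod_haagerupWeight_le (N k : ℕ) (a b : Fin k → FG) :
    ∑ v : Fin k → Fin N, ∑ w : Fin k → Fin N, ∏ j, haagerupWeight (v j) (w j) (a j) (b j)
      ≤ (N + 9) ^ k := by
  calc ∑ v : Fin k → Fin N, ∑ w : Fin k → Fin N, ∏ j, haagerupWeight (v j) (w j) (a j) (b j)
      = ∑ q : Fin k → Fin N × Fin N, ∏ j, haagerupWeight (q j).1 (q j).2 (a j) (b j) := by
        rw [← Fintype.sum_prod_type']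
        exact (Fintype.sum_equiv (Equiv.arrowProdEquivProdArrow (Fin k) (fun _ => Fin N)
          (fun _ => Fin N)) _ _ fun _ => rfl).symm
    _ = ∏ j : Fin k, ∑ p : Fin N × Fin N, haagerupWeight p.1 p.2 (a j) (b j) := by
        rw [Finset.prod_univ_sum, Fintype.piFinset_univ]
    _ ≤ ∏ _j : Fin k, (N + 9) := Finset.prod_le_prod' fun j _ => sum_haagerupWeight_le N _ _
    _ = (N + 9) ^ k := by simp

lemma ENNReal.two_mul_mul_le_sq_add_sq (p q : ℝ≥0∞) : 2 * (p * q) ≤ p ^ 2 + q ^ 2 := by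
  by_cases hp : p = ∞
  · simp [hp]
  by_cases hq : q = ∞
  · simp [hq]
  lift p to NNReal using hp
  lift q to NNReal using hq
  norm_cast
  have := two_mul_le_add_sq (p : ℝ) q
  rw [mul_assoc] at this
  exact_mod_cast this

lemma ENNReal.sq_sum_le_card_mul_sum_sq {ι : Type*} (s : Finset ι) (f : ι → ℝ≥0∞) :
    (∑ i ∈ s, f i) ^ 2 ≤ s.card * ∑ i ∈ s, f i ^ 2 := by
  have h2 : (2 : ℝ≥0∞) * (∑ i ∈ s, f i) ^ 2 ≤ 2 * (s.card * ∑ i ∈ s, f i ^ 2) := by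
    calc (2 : ℝ≥0∞) * (∑ i ∈ s, f i) ^ 2 = ∑ i ∈ s, ∑ j ∈ s, 2 * (f i * f j) := by
          rw [sq, Finset.sum_mul_sum, Finset.mul_sum]
          simp_rw [Finset.mul_sum]
      _ ≤ ∑ i ∈ s, ∑ j ∈ s, (f i ^ 2 + f j ^ 2) := by
          gcongr
          exact ENNReal.two_mul_mul_le_sq_add_sq _ _
      _ = 2 * (s.card * ∑ i ∈ s, f i ^ 2) := by
          simp only [Finset.sum_add_distrib, Finset.sum_const, nsmul_eq_mul, ← Finset.mul_sum]
          ring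
  exact (ENNReal.mul_le_mul_iff_right (by norm_num) (by norm_num)).1 h2

lemma ENNReal.tsum_mul_tsum {α β : Type*} (f : α → ℝ≥0∞) (g : β → ℝ≥0∞) :
    (∑' a, f a) * ∑' b, g b = ∑' p : α × β, f p.1 * g p.2 := by
  rw [ENNReal.tsum_prod', ← ENNReal.tsum_mul_right]
  simp_rw [ENNReal.tsum_mul_left]

open scoped Classical in
/-- Cauchy–Schwarz after splitting the sum along the fibres of `τ`. -/
lemma ENNReal.sq_tsum_mul_le_card_mul {X T : Type*} (τ : X → T) (s : Finset T)
    (hτ : ∀ x, τ x ∈ s) (f g : X → ℝ≥0∞) :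
    (∑' x, f x * g x) ^ 2 ≤
      ∑' p : X × X, if τ p.1 = τ p.2 then (s.card : ℝ≥0∞) * (f p.1 ^ 2 * g p.2 ^ 2) else 0 := by
  have hsplit : ∑' x, f x * g x = ∑ t ∈ s, ∑' x, if τ x = t then f x * g x else 0 := by
    rw [← Summable.tsum_finsetSum fun _ _ => ENNReal.summable]
    refine tsum_congr fun x => ?_
    rw [Finset.sum_ite_eq, if_pos (hτ x)]
  have hfib : ∀ t, (∑' x, if τ x = t then f x * g x else 0) ^ 2 ≤
      ∑' p : X × X, if τ p.1 = t ∧ τ p.2 = t then f p.1 ^ 2 * g p.2 ^ 2 else 0 := by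
    intro t
    set F : X × X → ℝ≥0∞ := fun p => if τ p.1 = t ∧ τ p.2 = t then f p.1 ^ 2 * g p.2 ^ 2 else 0
    have hswap : ∑' p : X × X, F p.swap = ∑' p, F p := (Equiv.prodComm X X).tsum_eq F
    have h2 : 2 * (∑' x, if τ x = t then f x * g x else 0) ^ 2 ≤ 2 * ∑' p, F p := by
      rw [sq, ENNReal.tsum_mul_tsum, ← ENNReal.tsum_mul_left, two_mul (∑' p, F p)]
      nth_rewrite 2 [← hswap]
      rw [← ENNReal.tsum_add]
      refine ENNReal.tsum_le_tsum fun p => ?_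
      by_cases h1 : τ p.1 = t <;> by_cases h2 : τ p.2 = t <;> simp [F, h1, h2]
      have := ENNReal.two_mul_mul_le_sq_add_sq (f p.1 * g p.2) (f p.2 * g p.1)
      calc 2 * (f p.1 * g p.1 * (f p.2 * g p.2))
          = 2 * (f p.1 * g p.2 * (f p.2 * g p.1)) := by ring
        _ ≤ _ := this
        _ = _ := by ring
    exact (ENNReal.mul_le_mul_iff_right (by norm_num) (by norm_num)).1 h2
  rw [hsplit]
  refine (ENNReal.sq_sum_le_card_mul_sum_sq s _).trans ?_
  calc (s.card : ℝ≥0∞) * ∑ t ∈ s, (∑' x, if τ x = t then f x * g x else 0) ^ 2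
      ≤ s.card * ∑ t ∈ s,
          ∑' p : X × X, if τ p.1 = t ∧ τ p.2 = t then f p.1 ^ 2 * g p.2 ^ 2 else 0 := by
        gcongr with t
        exact hfib t
    _ = _ := by
        rw [← Summable.tsum_finsetSum fun _ _ => ENNReal.summable, ← ENNReal.tsum_mul_left]
        refine tsum_congr fun p => ?_
        by_cases h : τ p.1 = τ p.2
        · simp [h, hτ]
        · rw [if_neg h, Finset.sum_eq_zero, mul_zero]
          rintro t -
          rw [if_neg]
          rintro ⟨h1, h2⟩
          exact h (h1.trans h2.symm)

/-- Simultaneous left translation by `g_{v_1}⁻¹, …, g_{v_k}⁻¹`. -/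
def shift {N k : ℕ} (v : Fin k → Fin N) : (Fin k → FG) ≃ (Fin k → FG) :=
  Equiv.piCongrRight fun j => Equiv.mulLeft (gen (v j : ℕ))⁻¹

lemma sq_tsum_shift_le {N k : ℕ} (f : (Fin k → FG) → ℝ≥0∞) (v w : Fin k → Fin N) :
    (∑' x, f (shift w x) * f (shift v x)) ^ 2 ≤
      ∑' p : (Fin k → FG) × (Fin k → FG),
        (∏ j, haagerupWeight (v j) (w j) (p.1 j) (p.2 j) : ℕ) * (f p.1 ^ 2 * f p.2 ^ 2) := by
  classical
  set s : Finset (Fin k → Fin 3) := Fintype.piFinset fun j => if v j = w j then {0} else .univ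
  have hs : s.card = ∏ j, if v j = w j then 1 else 3 := by
    rw [Fintype.card_piFinset]
    refine Finset.prod_congr rfl fun j _ => ?_
    split_ifs <;> simp
  refine (ENNReal.sq_tsum_mul_le_card_mul (fun x j => cancelType (v j) (w j) (x j)) s ?_ _ _).trans
    ?_
  · intro x
    rw [Fintype.mem_piFinset]
    intro j
    split_ifs with h
    · simp [cancelType, h]
    · simp
  · refine le_of_le_of_eq ?_ (((shift w).prodCongr (shift v)).tsum_eq _)
    refine ENNReal.tsum_le_tsum fun p => ?_
    split_ifs with h
    · refine mul_le_mul' ?_ le_rfl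
      rw [hs]
      exact_mod_cast Finset.prod_le_prod' fun j _ => card_le_haagerupWeight (congrFun h j)
    · exact zero_le

lemma sum_sq_tsum_shift_le (N : ℕ) {k : ℕ} (f : (Fin k → FG) → ℝ≥0∞) :
    ∑ v : Fin k → Fin N, ∑ w : Fin k → Fin N, (∑' x, f (shift w x) * f (shift v x)) ^ 2 ≤
      (N + 9 : ℝ≥0∞) ^ k * (∑' x, f x ^ 2) ^ 2 := by
  calc _ ≤ ∑ v : Fin k → Fin N, ∑ w : Fin k → Fin N, ∑' p : (Fin k → FG) × (Fin k → FG),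
        (∏ j, haagerupWeight (v j) (w j) (p.1 j) (p.2 j) : ℕ) * (f p.1 ^ 2 * f p.2 ^ 2) := by
        gcongr
        exact sq_tsum_shift_le f _ _
    _ = ∑' p : (Fin k → FG) × (Fin k → FG), (∑ v : Fin k → Fin N, ∑ w : Fin k → Fin N,
        ∏ j, haagerupWeight (v j) (w j) (p.1 j) (p.2 j) : ℕ) * (f p.1 ^ 2 * f p.2 ^ 2) := by
        simp_rw [← Summable.tsum_finsetSum fun _ _ => ENNReal.summable, ← Finset.sum_mul]
        push_cast
        rfl
    _ ≤ ∑' p : (Fin k → FG) × (Fin k → FG), (N + 9 : ℝ≥0∞) ^ k * (f p.1 ^ 2 * f p.2 ^ 2) := by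
        refine ENNReal.tsum_le_tsum fun p => mul_le_mul' ?_ le_rfl
        exact_mod_cast sum_prod_haagerupWeight_le N k p.1 p.2
    _ = _ := by
        rw [ENNReal.tsum_mul_left, sq (∑' x, f x ^ 2), ENNReal.tsum_mul_tsum]

lemma innerUU_eq_tsum_shift {N k : ℕ} (ξ : l2 k) (w v : Fin k → Fin N) :
    innerUU ξ w v = ∑' x, (starRingEnd ℂ) (ξ (shift w x)) * ξ (shift v x) := rfl

lemma l2_hasSum_norm_sq {k : ℕ} (ξ : l2 k) : HasSum (fun x => ‖ξ x‖ ^ 2) (‖ξ‖ ^ 2) := by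
  simpa using lp.hasSum_norm (p := 2) (by simp) ξ

lemma tsum_enorm_sq_eq_one {k : ℕ} {ξ : l2 k} (hξ : ‖ξ‖ = 1) : ∑' x, ‖ξ x‖ₑ ^ 2 = 1 := by
  have h := l2_hasSum_norm_sq ξ
  rw [hξ, one_pow] at h
  have h' : ∀ x, ‖ξ x‖ₑ ^ 2 = ENNReal.ofReal (‖ξ x‖ ^ 2) := fun x => by
    rw [ENNReal.ofReal_pow (norm_nonneg _), ofReal_norm]
  simp_rw [h']
  rw [← ENNReal.ofReal_tsum_of_nonneg (fun _ => sq_nonneg _) h.summable, h.tsum_eq,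
    ENNReal.ofReal_one]

/-- The Haagerup-type bound on the overlaps of the translates of a unit vector. -/
lemma sum_sq_norm_innerUU_le (N : ℕ) {k : ℕ} {ξ : l2 k} (hξ : ‖ξ‖ = 1) :
    ∑ v : Fin k → Fin N, ∑ w : Fin k → Fin N, ‖innerUU ξ w v‖ ^ 2 ≤ (N + 9 : ℝ) ^ k := by
  have h1 : ∑ v : Fin k → Fin N, ∑ w : Fin k → Fin N, ‖innerUU ξ w v‖ₑ ^ 2 ≤
      (N + 9 : ℝ≥0∞) ^ k := by
    have h := sum_sq_tsum_shift_le N fun x => ‖ξ x‖ₑ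
    rw [tsum_enorm_sq_eq_one hξ, one_pow, mul_one] at h
    refine le_trans ?_ h
    gcongr with v _ w _
    rw [innerUU_eq_tsum_shift]
    refine enorm_tsum_le_tsum_enorm.trans_eq (tsum_congr fun x => ?_)
    rw [enorm_mul, RCLike.enorm_conj]
  have h2 := ENNReal.toReal_mono (by finiteness) h1
  have hfin : ∀ v w : Fin k → Fin N, ‖innerUU ξ w v‖ₑ ^ 2 ≠ ∞ := fun v w => by finiteness
  rw [ENNReal.toReal_sum fun v _ => ENNReal.sum_ne_top.2 fun w _ => hfin v w] at h2
  simp_rw [ENNReal.toReal_sum fun w _ => hfin _ w] at h2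
  simpa [ENNReal.toReal_add] using h2

/-- The translate `U_v ξ`. -/
def shiftVec {N k : ℕ} (ξ : l2 k) (v : Fin k → Fin N) : l2 k :=
  ⟨fun x => ξ (shift v x), (memℓp_gen_iff (by simp)).2
    (((lp.memℓp ξ).summable (by simp)).comp_injective (shift v).injective)⟩

lemma inner_shiftVec {N k : ℕ} (ξ : l2 k) (w v : Fin k → Fin N) :
    inner ℂ (shiftVec ξ w) (shiftVec ξ v) = innerUU ξ w v := by
  rw [lp.inner_eq_tsum, innerUU_eq_tsum_shift]
  exact tsum_congr fun x => mul_comm _ _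

lemma innerUU_self {N k : ℕ} {ξ : l2 k} (hξ : ‖ξ‖ = 1) (v : Fin k → Fin N) :
    innerUU ξ v v = 1 := by
  have h := ((shift v).hasSum_iff.2 (l2_hasSum_norm_sq ξ)).tsum_eq
  rw [hξ, one_pow] at h
  rw [innerUU_eq_tsum_shift]
  simp_rw [RCLike.conj_mul]
  have h' := congrArg Complex.ofReal h
  rw [Complex.ofReal_tsum] at h'
  simpa using h'

open scoped ComplexOrder in
lemma posSemidef_Gmat (N k : ℕ) (ξ : l2 k) : (Gmat N k ξ).PosSemidef := by
  have h : Gmat N k ξ =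
      ((((N : ℝ) ^ k)⁻¹ : ℝ) • (Matrix.gram ℂ fun v : Fin k → Fin N => shiftVec ξ v)).transpose := by
    ext v w
    simp [Gmat, inner_shiftVec]
  rw [h]
  exact ((Matrix.posSemidef_gram ℂ _).smul (by positivity)).transpose

lemma trace_Gmat {N k : ℕ} {ξ : l2 k} (hξ : ‖ξ‖ = 1) (hN : (N : ℂ) ^ k ≠ 0) :
    (Gmat N k ξ).trace = 1 := by
  simp [Matrix.trace, Gmat, innerUU_self hξ, hN]

lemma Matrix.IsHermitian.sum_sq_eigenvalues {n : Type*} [Fintype n] [DecidableEq n]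
    {A : Matrix n n ℂ} (hA : A.IsHermitian) :
    ∑ i, hA.eigenvalues i ^ 2 = ∑ i, ∑ j, ‖A i j‖ ^ 2 := by
  have h1 : (A * A).trace = ∑ i, (hA.eigenvalues i : ℂ) ^ 2 := by
    conv_lhs => rw [hA.spectral_theorem, ← map_mul, Unitary.conjStarAlgAut_apply,
      Matrix.trace_mul_cycle, Unitary.coe_star_mul_self, one_mul, Matrix.diagonal_mul_diagonal,
      Matrix.trace_diagonal]
    simp [sq]
  have h2 : (A * A).trace = ∑ i, ∑ j, (‖A i j‖ : ℂ) ^ 2 := by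
    simp only [Matrix.trace, Matrix.diag_apply, Matrix.mul_apply]
    refine Finset.sum_congr rfl fun i _ => Finset.sum_congr rfl fun j _ => ?_
    rw [← hA.apply j i, ← Complex.mul_conj']
    rfl
  exact_mod_cast h1.symm.trans h2

/-- The von Neumann entropy dominates the collision entropy. -/
lemma neg_log_le_sum_negMulLog {ι : Type*} [Fintype ι] {p : ι → ℝ} (h0 : ∀ i, 0 ≤ p i)
    (h1 : ∑ i, p i = 1) {s : ℝ} (hs : 0 < s) (hle : ∑ i, p i ^ 2 ≤ s) :
    -Real.log s ≤ ∑ i, Real.negMulLog (p i) := by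
  have key : ∀ i, p i - p i * Real.log s - p i ^ 2 / s ≤ Real.negMulLog (p i) := by
    intro i
    rcases (h0 i).eq_or_lt with h | h
    · simp [← h]
    · have h2 := Real.log_le_sub_one_of_pos (div_pos h hs)
      rw [Real.log_div h.ne' hs.ne'] at h2
      have h3 := mul_le_mul_of_nonneg_left h2 h.le
      rw [Real.negMulLog]
      have h4 : p i ^ 2 / s = p i * (p i / s) := by ring
      rw [h4]
      linarith
  have hsum := Finset.sum_le_sum fun i (_ : i ∈ Finset.univ) => key i
  rw [Finset.sum_sub_distrib, Finset.sum_sub_distrib, ← Finset.sum_mul, ← Finset.sum_div, h1]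
    at hsum
  have := (div_le_one hs).2 hle
  linarith

lemma le_sq_one_add_sqrt_sub_one {x : ℝ} (hx : 1 ≤ x) : x ≤ (1 + √(x - 1)) ^ 2 := by
  have := Real.sq_sqrt (sub_nonneg.2 hx)
  nlinarith [Real.sqrt_nonneg (x - 1)]

open scoped ComplexOrder in
lemma vnEntropy_Gmat_ge (N k : ℕ) (ξ : l2 k) (hξ : ‖ξ‖ = 1) :
    (k : ℝ) * Real.log N - 2 * Real.log (1 + Real.sqrt ((1 + 9 / (N : ℝ)) ^ k - 1))
      ≤ vnEntropy (Gmat N k ξ) := by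
  have hP := posSemidef_Gmat N k ξ
  rw [vnEntropy, dif_pos hP.isHermitian]
  by_cases hN : (N : ℝ) ^ k = 0
  · obtain ⟨hN0, hk⟩ := pow_eq_zero_iff'.1 hN
    have hN0' : N = 0 := by exact_mod_cast hN0
    subst hN0'
    have : IsEmpty (Fin k → Fin 0) := ⟨fun v => (v ⟨0, Nat.pos_of_ne_zero hk⟩).elim0⟩
    simp
  have hNpos : (0 : ℝ) < (N : ℝ) ^ k := lt_of_le_of_ne (by positivity) (Ne.symm hN)
  set X : ℝ := (1 + 9 / (N : ℝ)) ^ k with hX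
  have hX1 : 1 ≤ X := one_le_pow₀ (by
    have : (0 : ℝ) ≤ 9 / N := by positivity
    linarith)
  have hmul : (N : ℝ) ^ k * X = (N + 9 : ℝ) ^ k := by
    rcases Nat.eq_zero_or_pos k with rfl | hk
    · simp [hX]
    have hN0 : (N : ℝ) ≠ 0 := by
      rintro h
      simp [h, hk.ne'] at hN
    rw [hX, ← mul_pow]
    congr 1
    field_simp
  have hsq : ∑ i, hP.isHermitian.eigenvalues i ^ 2 ≤ X / (N : ℝ) ^ k := by
    rw [hP.isHermitian.sum_sq_eigenvalues]
    have h : ∀ v w, ‖Gmat N k ξ v w‖ ^ 2 = (((N : ℝ) ^ k)⁻¹) ^ 2 * ‖innerUU ξ w v‖ ^ 2 := by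
      intro v w
      simp [Gmat, mul_pow]
    simp_rw [h, ← Finset.mul_sum]
    refine (mul_le_mul_of_nonneg_left (sum_sq_norm_innerUU_le N hξ) (by positivity)).trans_eq ?_
    rw [← hmul]
    field_simp
  have htr : ∑ i, hP.isHermitian.eigenvalues i = 1 := by
    have := hP.isHermitian.trace_eq_sum_eigenvalues
    rw [trace_Gmat hξ (by exact_mod_cast hN)] at this
    rw [← RCLike.ofReal_sum] at this
    exact Complex.ofReal_eq_one.1 this.symm
  refine le_trans ?_ (neg_log_le_sum_negMulLog hP.eigenvalues_nonneg htr (by positivity) hsq)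
  rw [Real.log_div (by positivity) hN, Real.log_pow (x := (N : ℝ))]
  have := Real.log_le_log (by positivity) (le_sq_one_add_sqrt_sub_one hX1)
  rw [Real.log_pow (n := 2)] at this
  push_cast at this
  linarith

lemma exists_norm_eq_one_l2 (k : ℕ) : ∃ ξ : l2 k, ‖ξ‖ = 1 := by
  classical
  exact ⟨lp.single 2 (1 : Fin k → FG) 1, by rw [lp.norm_single (by simp)]; simp⟩

/-- For every unit vector `ξ ∈ ℓ²(F_∞^k)`, the von Neumann entropy of `G_k(ξ)` is at
least `k log N − 2 log(1 + √((1+9/N)^k − 1))`; in particular, the minimum output entropy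
of `Φ_N^{⊗k}` admits the same lower bound. -/
theorem entropy_Gmat_lower_bound (N k : ℕ) :
    (∀ ξ : l2 k, ‖ξ‖ = 1 →
      (k : ℝ) * Real.log N - 2 * Real.log (1 + Real.sqrt ((1 + 9 / (N : ℝ)) ^ k - 1))
        ≤ vnEntropy (Gmat N k ξ)) ∧
    (k : ℝ) * Real.log N - 2 * Real.log (1 + Real.sqrt ((1 + 9 / (N : ℝ)) ^ k - 1))
      ≤ sInf {x : ℝ | ∃ ξ : l2 k, ‖ξ‖ = 1 ∧ x = vnEntropy (Gmat N k ξ)} := by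
  have h := vnEntropy_Gmat_ge N k
  refine ⟨h, le_csInf ?_ ?_⟩
  · obtain ⟨ξ, hξ⟩ := exists_norm_eq_one_l2 k
    exact ⟨_, ξ, hξ, rfl⟩
  · rintro _ ⟨ξ, hξ, rfl⟩
    exact h ξ hξ
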